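/- Let f(x) = x^n − m ∈ ℤ[x] be a monic irreducible polynomial with n ≥ 2, α a complex root of f, K = ℚ(α), and ind(f) = (𝓞_K : ℤ[α]). Let p be a prime dividing m with ν_p(m) < n, and set d = gcd(n, ν_p(m)). If gcd(n, p, ν_p(m)) = 1 (equivalently, p does not divide d), then ν_p(ind(f)) = ((n−1)(ν_p(m)−1) + d − 1)/2. -/

import Mathlib

open Polynomial

/-- weighted sup-ball -/
def Bd {K : Type*} [Field K] [Algebra ℚ K] {n : ℕ} (b : Module.Basis (Fin n) ℚ K) (p : ℕ)
    [Fact p.Prime] (ρ : ℝ) (r : ℝ) (x : K) : Prop :=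
  ∀ j : Fin n, ‖((b.repr x j : ℚ) : ℚ_[p])‖ * ρ ^ (j : ℕ) ≤ r

section
variable {K : Type*} [Field K] [Algebra ℚ K] {n : ℕ} (b : Module.Basis (Fin n) ℚ K) (p : ℕ)
    [Fact p.Prime] {ρ : ℝ}

lemma Bd.add (hρ : 0 ≤ ρ) {r : ℝ} {x y : K} (hx : Bd b p ρ r x) (hy : Bd b p ρ r y) :
    Bd b p ρ r (x + y) := by
  intro j
  have h1 := hx j
  have h2 := hy j
  have h3 := Padic.nonarchimedean ((b.repr x j : ℚ) : ℚ_[p]) ((b.repr y j : ℚ) : ℚ_[p])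
  have h4 : 0 ≤ ρ ^ (j : ℕ) := by positivity
  simp only [map_add, Finsupp.add_apply, Rat.cast_add]
  rcases le_max_iff.1 h3 with h | h
  · exact (mul_le_mul_of_nonneg_right h h4).trans h1
  · exact (mul_le_mul_of_nonneg_right h h4).trans h2

lemma Bd.zero {r : ℝ} (hr : 0 ≤ r) : Bd b p ρ r (0 : K) := by
  intro j
  simpa using hr

lemma Bd.sum (hρ : 0 ≤ ρ) {r : ℝ} (hr : 0 ≤ r) {ι : Type*} (s : Finset ι) (f : ι → K)
    (h : ∀ i ∈ s, Bd b p ρ r (f i)) : Bd b p ρ r (∑ i ∈ s, f i) := by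
  classical
  induction s using Finset.induction_on with
  | empty => simpa using Bd.zero b p hr
  | insert a s ha ih =>
    rw [Finset.sum_insert ha]
    exact Bd.add b p hρ (h a (by simp)) (ih fun i hi => h i (by simp [hi]))

lemma Bd.smul {r : ℝ} {x : K} (c : ℚ) (hx : Bd b p ρ r x) :
    Bd b p ρ (‖(c : ℚ_[p])‖ * r) (c • x) := by
  intro j
  simp only [map_smul, Finsupp.smul_apply, smul_eq_mul, Rat.cast_mul, norm_mul, mul_assoc]
  exact mul_le_mul_of_nonneg_left (hx j) (norm_nonneg _)

lemma Bd.mono {r s : ℝ} {x : K} (hrs : r ≤ s) (hx : Bd b p ρ r x) : Bd b p ρ s x :=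
  fun j => (hx j).trans hrs

lemma repr_mono {θ : K} (hb : ∀ j, b j = θ ^ (j : ℕ)) {m : ℤ} (hθ : θ ^ n = (m : K))
    (hn : 0 < n) (c : ℚ) (k : ℕ) (j : Fin n) :
    b.repr (c • θ ^ k) j = if (j : ℕ) = k % n then c * (m : ℚ) ^ (k / n) else 0 := by
  have h1 : c • θ ^ k = (c * (m : ℚ) ^ (k / n)) • b ⟨k % n, Nat.mod_lt _ hn⟩ := by
    rw [hb, Algebra.smul_def, Algebra.smul_def]
    conv_lhs => rw [← Nat.div_add_mod k n, pow_add, pow_mul, hθ]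
    rw [map_mul, map_pow, map_intCast]
    ring
  rw [h1]
  simp only [map_smul, Finsupp.smul_apply, Module.Basis.repr_self, Finsupp.single_apply, Fin.ext_iff, smul_eq_mul]
  by_cases h : (j : ℕ) = k % n
  · simp [h]
  · rw [if_neg h, if_neg (fun h' => h h'.symm), mul_zero]

lemma weight_mono {m : ℤ} (hρn : ρ ^ n = ‖((m : ℚ) : ℚ_[p])‖) (c : ℚ) (k : ℕ) :
    ‖((c * (m : ℚ) ^ (k / n) : ℚ) : ℚ_[p])‖ * ρ ^ (k % n) = ‖(c : ℚ_[p])‖ * ρ ^ k := by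
  conv_rhs => rw [← Nat.div_add_mod k n, pow_add, pow_mul, hρn]
  push_cast
  rw [norm_mul, norm_pow]
  ring

lemma Bd.monomial {θ : K} (hb : ∀ j, b j = θ ^ (j : ℕ)) {m : ℤ} (hθ : θ ^ n = (m : K))
    (hn : 0 < n) (hρ : 0 ≤ ρ) (hρn : ρ ^ n = ‖((m : ℚ) : ℚ_[p])‖) (c : ℚ) (k : ℕ) :
    Bd b p ρ (‖(c : ℚ_[p])‖ * ρ ^ k) (c • θ ^ k) := by
  intro j
  rw [repr_mono b hb hθ hn]
  split_ifs with h
  · rw [h, weight_mono p hρn]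
  · rw [Rat.cast_zero, norm_zero, zero_mul]; positivity

lemma eq_sum {θ : K} (hb : ∀ j, b j = θ ^ (j : ℕ)) (x : K) :
    x = ∑ j : Fin n, b.repr x j • θ ^ (j : ℕ) := by
  conv_lhs => rw [← b.sum_repr x]
  simp [hb]

lemma Bd.mul {θ : K} (hb : ∀ j, b j = θ ^ (j : ℕ)) {m : ℤ} (hθ : θ ^ n = (m : K))
    (hn : 0 < n) (hρ : 0 ≤ ρ) (hρn : ρ ^ n = ‖((m : ℚ) : ℚ_[p])‖) {r s : ℝ} (hr : 0 ≤ r)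
    (hs : 0 ≤ s) {x y : K} (hx : Bd b p ρ r x) (hy : Bd b p ρ s y) : Bd b p ρ (r * s) (x * y) := by
  rw [eq_sum b hb x, eq_sum b hb y, Finset.sum_mul]
  refine Bd.sum b p hρ (by positivity) _ _ fun i _ => ?_
  rw [Finset.mul_sum]
  refine Bd.sum b p hρ (by positivity) _ _ fun j _ => ?_
  rw [smul_mul_smul_comm, ← pow_add]
  refine Bd.mono b p ?_ (Bd.monomial b p hb hθ hn hρ hρn _ _)
  calc _ = (‖((b.repr x i : ℚ) : ℚ_[p])‖ * ρ ^ (i : ℕ)) * (‖((b.repr y j : ℚ) : ℚ_[p])‖ * ρ ^ (j : ℕ)) := by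
        push_cast; rw [norm_mul]; ring
    _ ≤ r * s := mul_le_mul (hx i) (hy j) (by positivity) hr

lemma Bd.one {θ : K} (hb : ∀ j, b j = θ ^ (j : ℕ)) {m : ℤ} (hθ : θ ^ n = (m : K))
    (hn : 0 < n) (hρ : 0 ≤ ρ) (hρn : ρ ^ n = ‖((m : ℚ) : ℚ_[p])‖) : Bd b p ρ 1 (1 : K) := by
  simpa using Bd.monomial b p hb hθ hn hρ hρn 1 0

lemma Bd.pow {θ : K} (hb : ∀ j, b j = θ ^ (j : ℕ)) {m : ℤ} (hθ : θ ^ n = (m : K))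
    (hn : 0 < n) (hρ : 0 ≤ ρ) (hρn : ρ ^ n = ‖((m : ℚ) : ℚ_[p])‖) {r : ℝ} (hr : 0 ≤ r)
    {x : K} (hx : Bd b p ρ r x) (k : ℕ) : Bd b p ρ (r ^ k) (x ^ k) := by
  induction k with
  | zero => simpa using Bd.one b p hb hθ hn hρ hρn
  | succ k ih =>
    rw [pow_succ, pow_succ]
    exact Bd.mul b p hb hθ hn hρ hρn (by positivity) hr ih hx

lemma Bd.frob_add {θ : K} (hb : ∀ j, b j = θ ^ (j : ℕ)) {m : ℤ} (hθ : θ ^ n = (m : K))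
    (hn : 0 < n) (hρ : 0 ≤ ρ) (hρn : ρ ^ n = ‖((m : ℚ) : ℚ_[p])‖) {r : ℝ} (hr : 0 ≤ r)
    {x y : K} (hx : Bd b p ρ r x) (hy : Bd b p ρ r y) :
    Bd b p ρ ((p : ℝ)⁻¹ * r ^ p) ((x + y) ^ p - (x ^ p + y ^ p)) := by
  have hp : p.Prime := Fact.out
  rw [add_pow_prime_eq' hp, add_sub_cancel_left]
  have h1 : Bd b p ρ (r ^ p) (∑ k ∈ Finset.Ioo 0 p, x ^ k * y ^ (p - k) * ((p.choose k / p : ℕ) : K)) := by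
    refine Bd.sum b p hρ (by positivity) _ _ fun k hk => ?_
    have hk' := Finset.mem_Ioo.1 hk
    have h2 := Bd.mul b p hb hθ hn hρ hρn (by positivity) (by positivity)
      (Bd.pow b p hb hθ hn hρ hρn hr hx k) (Bd.pow b p hb hθ hn hρ hρn hr hy (p - k))
    rw [← pow_add, Nat.add_sub_cancel' hk'.2.le] at h2
    have h3 := Bd.smul b p ((p.choose k / p : ℕ) : ℚ) h2
    rw [Algebra.smul_def, map_natCast, mul_comm (_ : K)] at h3
    refine Bd.mono b p ?_ h3
    refine mul_le_of_le_one_left (by positivity) ?_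
    generalize p.choose k / p = N
    simpa using Padic.norm_int_le_one (p := p) (N : ℤ)
  have h4 := Bd.smul b p (p : ℚ) h1
  rw [Algebra.smul_def, map_natCast] at h4
  simpa using h4

lemma Bd.frob_sum {θ : K} (hb : ∀ j, b j = θ ^ (j : ℕ)) {m : ℤ} (hθ : θ ^ n = (m : K))
    (hn : 0 < n) (hρ : 0 ≤ ρ) (hρn : ρ ^ n = ‖((m : ℚ) : ℚ_[p])‖) {r : ℝ} (hr : 0 ≤ r)
    {ι : Type*} (s : Finset ι) (f : ι → K) (h : ∀ i ∈ s, Bd b p ρ r (f i)) :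
    Bd b p ρ ((p : ℝ)⁻¹ * r ^ p) ((∑ i ∈ s, f i) ^ p - ∑ i ∈ s, f i ^ p) := by
  classical
  have hp : p.Prime := Fact.out
  induction s using Finset.induction_on with
  | empty =>
    simp only [Finset.sum_empty, zero_pow hp.ne_zero, sub_zero]
    exact Bd.zero b p (by positivity)
  | insert a s ha ih =>
    rw [Finset.sum_insert ha, Finset.sum_insert ha]
    have h1 := Bd.frob_add b p hb hθ hn hρ hρn hr (h a (by simp))
      (Bd.sum b p hρ hr s f fun i hi => h i (by simp [hi]))
    have h2 := Bd.add b p hρ h1 (ih fun i hi => h i (by simp [hi]))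
    convert h2 using 1
    ring


lemma weight_class {m : ℤ} {v : ℕ} (hm : ‖((m : ℚ) : ℚ_[p])‖ = (p : ℝ) ^ (-(v : ℤ)))
    (hρn : ρ ^ n = ‖((m : ℚ) : ℚ_[p])‖) {a a' : ℚ_[p]} (ha : a ≠ 0) (ha' : a' ≠ 0)
    {i j : ℕ} (h : ‖a‖ * ρ ^ i = ‖a'‖ * ρ ^ j) : (n : ℤ) ∣ ((i : ℤ) - j) * v := by
  have hp : p.Prime := Fact.out
  have hp1 : (1 : ℝ) < p := by exact_mod_cast hp.one_lt
  have key : ∀ (c : ℚ_[p]) (k : ℕ), c ≠ 0 →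
      (‖c‖ * ρ ^ k) ^ n = (p : ℝ) ^ (-(c.valuation * n + v * k : ℤ)) := by
    intro c k hc
    rw [mul_pow, ← pow_mul, mul_comm k n, pow_mul, hρn, hm, Padic.norm_eq_zpow_neg_valuation hc,
      ← zpow_natCast, ← zpow_natCast, ← zpow_mul, ← zpow_mul, ← zpow_add₀ (by positivity)]
    congr 1
    ring
  have h2 := congrArg (· ^ n) h
  simp only [key a i ha, key a' j ha'] at h2
  have h3 := zpow_right_injective₀ (by positivity) hp1.ne' h2
  exact ⟨a'.valuation - a.valuation, by linarith⟩

lemma frob_step {θ : K} (hb : ∀ j, b j = θ ^ (j : ℕ)) {m : ℤ} (hθ : θ ^ n = (m : K))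
    (hn : 0 < n) (hρ : 0 < ρ) (hρn : ρ ^ n = ‖((m : ℚ) : ℚ_[p])‖) {v : ℕ}
    (hm : ‖((m : ℚ) : ℚ_[p])‖ = (p : ℝ) ^ (-(v : ℤ))) (hg : Nat.gcd (Nat.gcd n p) v = 1)
    {r : ℝ} (hr : 0 < r) {x : K} (hx : Bd b p ρ r x) (j0 : Fin n)
    (hj0 : ‖((b.repr x j0 : ℚ) : ℚ_[p])‖ * ρ ^ (j0 : ℕ) = r) :
    ∃ j1 : Fin n, ‖((b.repr (x ^ p) j1 : ℚ) : ℚ_[p])‖ * ρ ^ (j1 : ℕ) = r ^ p := by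
  classical
  have hp : p.Prime := Fact.out
  have hp1 : (1 : ℝ) < p := by exact_mod_cast hp.one_lt
  set j1 : Fin n := ⟨(j0 * p) % n, Nat.mod_lt _ hn⟩ with hj1
  refine ⟨j1, ?_⟩
  have hρ1 : 0 < ρ ^ (j1 : ℕ) := by positivity
  set S : Set ℚ := {c | ‖(c : ℚ_[p])‖ * ρ ^ (j1 : ℕ) < r ^ p} with hS
  have hSadd : ∀ c d : ℚ, c ∈ S → d ∈ S → c + d ∈ S := by
    intro c d hc hd
    simp only [hS, Set.mem_ofPred_eq, Rat.cast_add] at *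
    rcases le_max_iff.1 (Padic.nonarchimedean (c : ℚ_[p]) (d : ℚ_[p])) with h | h
    · exact (mul_le_mul_of_nonneg_right h hρ1.le).trans_lt hc
    · exact (mul_le_mul_of_nonneg_right h hρ1.le).trans_lt hd
  have hS0 : (0 : ℚ) ∈ S := by
    simp only [hS, Set.mem_ofPred_eq, Rat.cast_zero, norm_zero, zero_mul]; positivity
  set y : Fin n → K := fun i => b.repr x i • θ ^ (i : ℕ) with hy
  have hxy : x = ∑ i, y i := eq_sum b hb x
  have hyB : ∀ i ∈ Finset.univ, Bd b p ρ r (y i) := fun i _ =>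
    Bd.mono b p (hx i) (Bd.monomial b p hb hθ hn hρ.le hρn _ _)
  have herr := Bd.frob_sum b p hb hθ hn hρ.le hρn hr.le Finset.univ y hyB
  rw [← hxy] at herr
  set E := x ^ p - ∑ i, y i ^ p with hE
  have hxp : x ^ p = y j0 ^ p + (∑ i ∈ Finset.univ.erase j0, y i ^ p + E) := by
    rw [← add_assoc, Finset.add_sum_erase _ (fun i => y i ^ p) (Finset.mem_univ j0), hE]; ring
  have hyp : ∀ i, y i ^ p = ((b.repr x i) ^ p) • θ ^ ((i : ℕ) * p) := by
    intro i; simp only [hy]; rw [_root_.smul_pow, ← pow_mul]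
  have hES : b.repr E j1 ∈ S := by
    simp only [hS, Set.mem_ofPred_eq]
    refine (herr j1).trans_lt ?_
    have : (p : ℝ)⁻¹ < 1 := inv_lt_one_of_one_lt₀ hp1
    have hrp : 0 < r ^ p := by positivity
    nlinarith
  have hw : ∀ i : Fin n, ‖(((b.repr x i) ^ p * (m : ℚ) ^ ((i : ℕ) * p / n) : ℚ) : ℚ_[p])‖ *
      ρ ^ ((i : ℕ) * p % n) = (‖((b.repr x i : ℚ) : ℚ_[p])‖ * ρ ^ (i : ℕ)) ^ p := by
    intro i
    rw [weight_mono p hρn]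
    push_cast
    rw [norm_pow, mul_pow, pow_mul]
  have hrest : ∀ i ∈ Finset.univ.erase j0, b.repr (y i ^ p) j1 ∈ S := by
    intro i hi
    have hij : i ≠ j0 := (Finset.mem_erase.1 hi).1
    rw [hyp, repr_mono b hb hθ hn]
    split_ifs with h
    · simp only [hS, Set.mem_ofPred_eq]
      rw [h, hw]
      refine pow_lt_pow_left₀ (lt_of_le_of_ne (hx i) ?_) (by positivity) hp.ne_zero
      intro heq
      apply hij
      have hne : ∀ k : Fin n, ‖((b.repr x k : ℚ) : ℚ_[p])‖ * ρ ^ (k : ℕ) = r →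
          ((b.repr x k : ℚ) : ℚ_[p]) ≠ 0 := by
        intro k hk h0
        rw [h0, norm_zero, zero_mul] at hk
        exact hr.ne hk
      have d1 := weight_class p hm hρn (hne i heq) (hne j0 hj0) (heq.trans hj0.symm)
      have d2 : (n : ℤ) ∣ ((i : ℤ) - (j0 : ℕ)) * p := by
        have h' : ((j0 : ℕ) * p) % n = ((i : ℕ) * p) % n := h
        have := (Nat.modEq_iff_dvd.1 h')
        push_cast at this
        rw [sub_mul]; exact this
      have d3 : (n : ℤ) ∣ ((i : ℤ) - (j0 : ℕ)) * n := dvd_mul_left _ _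
      have d4 : (n : ℤ) ∣ ((i : ℤ) - (j0 : ℕ)) := by
        rw [← Int.natAbs_dvd_natAbs] at d1 d2 d3 ⊢
        rw [Int.natAbs_mul] at d1 d2 d3
        simp only [Int.natAbs_natCast] at *
        have := Nat.dvd_gcd (Nat.dvd_gcd d3 d2) d1
        rwa [Nat.gcd_mul_left, Nat.gcd_mul_left, hg, mul_one] at this
      have h0 := Int.eq_zero_of_abs_lt_dvd d4 (by
        have := i.2; have := j0.2
        rw [abs_lt]; constructor <;> omega)
      apply Fin.ext; omega
    · exact hS0
  have hrestS : b.repr (∑ i ∈ Finset.univ.erase j0, y i ^ p + E) j1 ∈ S := by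
    rw [map_add, Finsupp.add_apply]
    refine hSadd _ _ ?_ hES
    rw [map_sum, Finsupp.finsetSum_apply]
    exact Finset.sum_induction _ (· ∈ S) (fun a c => hSadd a c) hS0 hrest
  have hmain : ‖((b.repr (y j0 ^ p) j1 : ℚ) : ℚ_[p])‖ * ρ ^ (j1 : ℕ) = r ^ p := by
    rw [hyp, repr_mono b hb hθ hn, if_pos rfl, hj1, hw, hj0]
  rw [hxp, map_add, Finsupp.add_apply, Rat.cast_add]
  simp only [hS, Set.mem_ofPred_eq] at hrestS
  rw [← hmain] at hrestS
  have hlt := lt_of_mul_lt_mul_right hrestS hρ1.le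
  rw [Padic.add_eq_max_of_ne hlt.ne', max_eq_left hlt.le, hmain]

lemma frob_iter {θ : K} (hb : ∀ j, b j = θ ^ (j : ℕ)) {m : ℤ} (hθ : θ ^ n = (m : K))
    (hn : 0 < n) (hρ : 0 < ρ) (hρn : ρ ^ n = ‖((m : ℚ) : ℚ_[p])‖) {v : ℕ}
    (hm : ‖((m : ℚ) : ℚ_[p])‖ = (p : ℝ) ^ (-(v : ℤ))) (hg : Nat.gcd (Nat.gcd n p) v = 1)
    {r : ℝ} (hr : 0 < r) {x : K} (hx : Bd b p ρ r x) (j0 : Fin n)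
    (hj0 : ‖((b.repr x j0 : ℚ) : ℚ_[p])‖ * ρ ^ (j0 : ℕ) = r) (k : ℕ) :
    ∃ j1 : Fin n, ‖((b.repr (x ^ p ^ k) j1 : ℚ) : ℚ_[p])‖ * ρ ^ (j1 : ℕ) = r ^ p ^ k := by
  induction k with
  | zero => exact ⟨j0, by simpa using hj0⟩
  | succ k ih =>
    obtain ⟨j1, h1⟩ := ih
    have := frob_step b p hb hθ hn hρ hρn hm hg (by positivity)
      (Bd.pow b p hb hθ hn hρ.le hρn hr.le hx (p ^ k)) j1 h1
    simpa only [← pow_mul, ← pow_succ] using this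

lemma Bd_one_of_bounded {θ : K} (hb : ∀ j, b j = θ ^ (j : ℕ)) {m : ℤ} (hθ : θ ^ n = (m : K))
    (hn : 0 < n) (hρ : 0 < ρ) (hρn : ρ ^ n = ‖((m : ℚ) : ℚ_[p])‖) {v : ℕ}
    (hm : ‖((m : ℚ) : ℚ_[p])‖ = (p : ℝ) ^ (-(v : ℤ))) (hg : Nat.gcd (Nat.gcd n p) v = 1)
    {x : K} (C : ℝ) (hC : ∀ k : ℕ, Bd b p ρ C (x ^ k)) : Bd b p ρ 1 x := by
  have hp : p.Prime := Fact.out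
  have : Nonempty (Fin n) := ⟨⟨0, hn⟩⟩
  obtain ⟨j0, -, hj0⟩ := Finset.exists_max_image Finset.univ
    (fun j : Fin n => ‖((b.repr x j : ℚ) : ℚ_[p])‖ * ρ ^ (j : ℕ)) Finset.univ_nonempty
  set r := ‖((b.repr x j0 : ℚ) : ℚ_[p])‖ * ρ ^ (j0 : ℕ) with hr
  have hx : Bd b p ρ r x := fun j => hj0 j (Finset.mem_univ _)
  by_contra hcon
  have hr1 : 1 < r := by
    by_contra h
    exact hcon (Bd.mono b p (not_lt.1 h) hx)
  obtain ⟨k, hk⟩ := pow_unbounded_of_one_lt C hr1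
  obtain ⟨j1, h1⟩ := frob_iter b p hb hθ hn hρ hρn hm hg (by linarith) hx j0 rfl k
  have h2 := hC (p ^ k) j1
  rw [h1] at h2
  have h3 : r ^ k ≤ r ^ p ^ k := pow_le_pow_right₀ hr1.le (Nat.lt_pow_self hp.one_lt).le
  linarith

end
lemma count_div (n v : ℕ) (hn : 0 < n) :
    ((Finset.range n).filter (fun j => n ∣ j * v)).card = Nat.gcd n v := by
  set d := Nat.gcd n v with hd
  have hd0 : 0 < d := Nat.gcd_pos_of_pos_left _ hn
  obtain ⟨e, he⟩ : d ∣ n := Nat.gcd_dvd_left n v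
  have he0 : 0 < e := by
    rcases Nat.eq_zero_or_pos e with h | h
    · simp [h] at he; omega
    · exact h
  have hiff : ∀ j, n ∣ j * v ↔ e ∣ j := by
    intro j
    obtain ⟨h, hh⟩ : d ∣ v := Nat.gcd_dvd_right n v
    have hc : Nat.Coprime e h := by
      have := Nat.coprime_div_gcd_div_gcd (m := n) (n := v) hd0
      rw [← hd] at this
      rwa [Nat.div_eq_of_eq_mul_right hd0 he, Nat.div_eq_of_eq_mul_right hd0 hh] at this
    rw [he, hh, show j * (d * h) = d * (j * h) by ring, Nat.mul_dvd_mul_iff_left hd0]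
    exact hc.dvd_mul_right
  have : (Finset.range n).filter (fun j => n ∣ j * v) = (Finset.range d).image (fun i => e * i) := by
    ext j
    simp only [Finset.mem_filter, Finset.mem_range, Finset.mem_image, hiff]
    constructor
    · rintro ⟨hj, i, rfl⟩
      refine ⟨i, ?_, rfl⟩
      rw [he, mul_comm d e] at hj
      exact lt_of_mul_lt_mul_left hj (Nat.zero_le _)
    · rintro ⟨i, hi, rfl⟩
      refine ⟨?_, dvd_mul_right _ _⟩
      rw [he, mul_comm d e]
      exact Nat.mul_lt_mul_of_pos_left hi he0
  rw [this, Finset.card_image_of_injective _ (fun a c h => Nat.eq_of_mul_eq_mul_left he0 h),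
    Finset.card_range]

lemma floor_sum (n v : ℕ) (hn : 0 < n) (hv : 0 < v) :
    ∑ j ∈ Finset.range n, (j * v / n) = ((n - 1) * (v - 1) + Nat.gcd n v - 1) / 2 := by
  obtain ⟨k, rfl⟩ : ∃ k, n = k + 1 := ⟨n - 1, by omega⟩
  obtain ⟨w, rfl⟩ : ∃ w, v = w + 1 := ⟨v - 1, by omega⟩
  have hcard := count_div (k + 1) (w + 1) hn
  rw [Finset.card_filter, Finset.sum_range_succ'] at hcard
  rw [Finset.sum_range_succ']
  simp only [zero_mul, dvd_zero, if_true, Nat.zero_div, add_zero] at hcard ⊢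
  have hrefl := Finset.sum_range_reflect (fun j => (j + 1) * (w + 1) / (k + 1)) k
  have hpair : ∑ j ∈ Finset.range k, ((j + 1) * (w + 1) / (k + 1) +
      (k - 1 - j + 1) * (w + 1) / (k + 1)) =
      ∑ j ∈ Finset.range k, (w + if (k + 1) ∣ (j + 1) * (w + 1) then 1 else 0) := by
    refine Finset.sum_congr rfl fun j hj => ?_
    have hj' := Finset.mem_range.1 hj
    have h1 : (j + 1) * (w + 1) + (k - 1 - j + 1) * (w + 1) = (k + 1) * (w + 1) := by
      rw [← add_mul]; congr 1; omega
    generalize (j + 1) * (w + 1) = A at *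
    generalize (k - 1 - j + 1) * (w + 1) = B at *
    have hB : B = (k + 1) * (w + 1) - A := by omega
    have hA := Nat.div_add_mod A (k + 1)
    have hAl := Nat.mod_lt A hn
    have hB2 := Nat.div_add_mod B (k + 1)
    have hBl := Nat.mod_lt B hn
    generalize A / (k + 1) = qa at *
    generalize B / (k + 1) = qb at *
    split_ifs with h
    · have hz := Nat.mod_eq_zero_of_dvd h
      rw [hz] at hA
      have h2 : (k + 1) * (qa + qb) + B % (k + 1) = (k + 1) * (w + 1) := by
        rw [mul_add]; omega
      by_contra hne
      rcases Nat.lt_or_gt_of_ne hne with h3 | h3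
      · have : (k + 1) * (qa + qb + 1) ≤ (k + 1) * (w + 1) := Nat.mul_le_mul_left _ h3
        rw [mul_add _ (qa + qb)] at this; omega
      · have : (k + 1) * (w + 1 + 1) ≤ (k + 1) * (qa + qb) := Nat.mul_le_mul_left _ h3
        rw [mul_add _ (w + 1)] at this; omega
    · have hz : A % (k + 1) ≠ 0 := fun h0 => h (Nat.dvd_of_mod_eq_zero h0)
      have h2 : (k + 1) * (qa + qb) + (A % (k + 1) + B % (k + 1)) = (k + 1) * (w + 1) := by
        rw [mul_add]; omega
      by_contra hne
      rcases Nat.lt_or_gt_of_ne hne with h3 | h3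
      · have : (k + 1) * (qa + qb + 1 + 1) ≤ (k + 1) * (w + 1) :=
          Nat.mul_le_mul_left _ (by omega)
        rw [mul_add _ (qa + qb + 1), mul_add _ (qa + qb)] at this; omega
      · have : (k + 1) * (w + 1) ≤ (k + 1) * (qa + qb) := Nat.mul_le_mul_left _ (by omega)
        omega
  rw [Finset.sum_add_distrib, hrefl, Finset.sum_add_distrib] at hpair
  simp only [Finset.sum_const, Finset.card_range, smul_eq_mul] at hpair
  simp only [Nat.add_sub_cancel]
  omega

section
variable {K : Type*} [Field K] [Algebra ℚ K] {n : ℕ} (b : Module.Basis (Fin n) ℚ K)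

lemma coords_of_mem {θ : K} (hb : ∀ j, b j = θ ^ (j : ℕ)) {m : ℤ} (hθ : θ ^ n = (m : K))
    (hn : 0 < n) {y : K} (hy : y ∈ Algebra.adjoin ℤ {θ}) (j : Fin n) :
    ∃ z : ℤ, b.repr y j = z := by
  rw [Algebra.adjoin_singleton_eq_range_aeval] at hy
  obtain ⟨q, rfl⟩ := hy
  change ∃ z : ℤ, b.repr (aeval θ q) j = z
  rw [aeval_eq_sum_range, map_sum, Finsupp.finsetSum_apply]
  refine ⟨∑ i ∈ Finset.range (q.natDegree + 1),
    if (j : ℕ) = i % n then q.coeff i * m ^ (i / n) else 0, ?_⟩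
  push_cast
  refine Finset.sum_congr rfl fun i _ => ?_
  have : q.coeff i • θ ^ i = ((q.coeff i : ℤ) : ℚ) • θ ^ i := by
    rw [Int.cast_smul_eq_zsmul]
  rw [this, repr_mono b hb hθ hn]

lemma val_bound (p : ℕ) [Fact p.Prime] {ρ : ℝ} (hρ : 0 < ρ) {v : ℕ} (hn : 0 < n)
    (hρn : ρ ^ n = (p : ℝ) ^ (-(v : ℤ))) {a : ℚ_[p]} {j : ℕ} (h : ‖a‖ * ρ ^ j ≤ 1) :
    ‖a * (p : ℚ_[p]) ^ (j * v / n)‖ ≤ 1 := by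
  have hp : p.Prime := Fact.out
  have hp1 : (1 : ℝ) < p := by exact_mod_cast hp.one_lt
  rcases eq_or_ne a 0 with rfl | ha
  · simp
  rw [norm_mul, norm_pow, Padic.norm_p, Padic.norm_eq_zpow_neg_valuation ha, inv_pow,
    ← zpow_natCast, ← zpow_neg, ← zpow_add₀ (by positivity), ← zpow_zero (p : ℝ),
    zpow_le_zpow_iff_right₀ hp1]
  have h2 := pow_le_one₀ (n := n) (by positivity) h
  rw [mul_pow, ← pow_mul, mul_comm j n, pow_mul, hρn, Padic.norm_eq_zpow_neg_valuation ha,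
      ← zpow_natCast, ← zpow_natCast, ← zpow_mul, ← zpow_mul, ← zpow_add₀ (by positivity),
      ← zpow_zero (p : ℝ), zpow_le_zpow_iff_right₀ hp1] at h2
  have h3 : j * v < n * (j * v / n + 1) := Nat.lt_mul_div_succ _ hn
  generalize (j * v / n) = F at *
  zify at h3
  by_contra hc
  have h4 : a.valuation + (F : ℤ) + 1 ≤ 0 := by omega
  have hn' : (0 : ℤ) < n := by exact_mod_cast hn
  have h5 := mul_nonpos_of_nonneg_of_nonpos hn'.le h4
  nlinarith

end

lemma coe_sum_zsmul {K : Type*} [Field K] {n : ℕ} (z : Fin n → ℤ)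
    (β : Fin n → NumberField.RingOfIntegers K) :
    ((∑ i, z i • β i : NumberField.RingOfIntegers K) : K) = ∑ i, z i • (β i : K) := by
  have := map_sum (algebraMap (NumberField.RingOfIntegers K) K) (fun i => z i • β i) Finset.univ
  simpa only [map_zsmul] using this

lemma sum_mem_adjoin {R : Type*} [CommRing R] {n : ℕ} (θ : R) (z : Fin n → ℤ) :
    ∑ j : Fin n, z j • θ ^ (j : ℕ) ∈ Algebra.adjoin ℤ {θ} :=
  sum_mem fun j _ => zsmul_mem (pow_mem (Algebra.subset_adjoin (Set.mem_singleton θ)) _) _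

set_option maxHeartbeats 1000000 in
theorem padicValNat_index_eq
    {K : Type*} [Field K] [NumberField K] (n : ℕ) (m : ℤ) (hn : 2 ≤ n)
    (hirr : Irreducible ((X : ℤ[X]) ^ n - C m))
    (θ : NumberField.RingOfIntegers K)
    (hroot : Polynomial.aeval θ ((X : ℤ[X]) ^ n - C m) = 0)
    (hgen : Algebra.adjoin ℚ {(θ : K)} = ⊤)
    (p : ℕ) (hp : p.Prime) (hpm : (p : ℤ) ∣ m) (hvn : padicValInt p m < n)
    (hgcd : Nat.gcd (Nat.gcd n p) (padicValInt p m) = 1) :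
    padicValNat p
        ((Subalgebra.toSubmodule (Algebra.adjoin ℤ {θ})).toAddSubgroup.index) =
      ((n - 1) * (padicValInt p m - 1) + Nat.gcd n (padicValInt p m) - 1) / 2 := by
  have hn0 : 0 < n := by omega
  have : Fact p.Prime := ⟨hp⟩
  have hp1 : (1 : ℝ) < p := by exact_mod_cast hp.one_lt
  have hm0 : m ≠ 0 := by
    rintro rfl
    rw [C_0, sub_zero] at hirr
    exact not_irreducible_pow (by omega) hirr
  have hθ' : θ ^ n = (m : NumberField.RingOfIntegers K) := by
    simpa [sub_eq_zero] using hroot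
  have hθ : (θ : K) ^ n = (m : K) := by
    have := congrArg (algebraMap (NumberField.RingOfIntegers K) K) hθ'
    simpa using this
  set v := padicValInt p m with hv
  have hv0 : 0 < v := by
    rw [Nat.pos_iff_ne_zero]
    intro h0
    rw [hv, padicValInt.eq_zero_iff] at h0
    rcases h0 with h0 | h0 | h0
    · exact hp.ne_one h0
    · exact hm0 h0
    · exact h0 hpm
  have hmv : ‖((m : ℚ) : ℚ_[p])‖ = (p : ℝ) ^ (-(v : ℤ)) := by
    rw [Padic.eq_padicNorm, padicNorm.eq_zpow_of_nonzero (by exact_mod_cast hm0),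
      padicValRat.of_int]
    push_cast
    rfl
  -- power basis
  have hmin : minpoly ℚ (θ : K) = X ^ n - C (m : ℚ) := by
    have hmon : ((X : ℤ[X]) ^ n - C m).Monic := monic_X_pow_sub_C m hn0.ne'
    have h1 := (hmon.irreducible_iff_irreducible_map_fraction_map (K := ℚ)).1 hirr
    have h2 : ((X : ℤ[X]) ^ n - C m).map (algebraMap ℤ ℚ) = X ^ n - C (m : ℚ) := by simp
    rw [h2] at h1
    refine (minpoly.eq_of_irreducible_of_monic h1 ?_ (monic_X_pow_sub_C _ hn0.ne')).symm
    simp [hθ]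
  obtain ⟨PB, hPBgen, hPBdim⟩ : ∃ PB : PowerBasis ℚ K, PB.gen = (θ : K) ∧ PB.dim = n := by
    refine ⟨PowerBasis.ofAdjoinEqTop (Algebra.IsIntegral.isIntegral (θ : K)) hgen,
      PowerBasis.ofAdjoinEqTop_gen _ _, ?_⟩
    rw [PowerBasis.ofAdjoinEqTop_dim, hmin, natDegree_X_pow_sub_C]
  obtain ⟨b, hb⟩ : ∃ b : Module.Basis (Fin n) ℚ K, ∀ j, b j = (θ : K) ^ (j : ℕ) := by
    refine ⟨PB.basis.reindex (finCongr hPBdim), fun j => ?_⟩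
    simp [hPBgen]
  -- denominators
  obtain ⟨D, hD0, hD⟩ : ∃ D : ℤ, D ≠ 0 ∧ ∀ x : NumberField.RingOfIntegers K,
      (D : K) * (x : K) ∈ Algebra.adjoin ℤ {(θ : K)} := by
    have hd0 : Algebra.discr ℚ PB.basis ≠ 0 := Algebra.discr_not_zero_of_basis ℚ PB.basis
    refine ⟨(Algebra.discr ℚ PB.basis).num, by simpa using hd0, fun x => ?_⟩
    have h1 := Algebra.discr_mul_isIntegral_mem_adjoin (R := ℤ) ℚ (B := PB)
      (by rw [hPBgen]; exact NumberField.RingOfIntegers.isIntegral_coe θ)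
      (NumberField.RingOfIntegers.isIntegral_coe x)
    rw [hPBgen] at h1
    have h2 := Subalgebra.smul_mem _ h1 ((Algebra.discr ℚ PB.basis).den : ℤ)
    generalize Algebra.discr ℚ PB.basis = q at *
    convert h2 using 1
    rw [← Int.cast_smul_eq_zsmul ℚ, smul_smul, Int.cast_natCast, Rat.den_mul_eq_num,
      Algebra.smul_def, map_intCast]
  -- rho
  obtain ⟨ρ, hρ, hρn⟩ : ∃ ρ : ℝ, 0 < ρ ∧ ρ ^ n = ‖((m : ℚ) : ℚ_[p])‖ := by
    have h0 : 0 < ‖((m : ℚ) : ℚ_[p])‖ := by rw [hmv]; positivity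
    exact ⟨‖((m : ℚ) : ℚ_[p])‖ ^ ((n : ℝ)⁻¹), by positivity,
      Real.rpow_inv_natCast_pow h0.le hn0.ne'⟩
  have hρ1 : ρ ≤ 1 := by
    have : ρ ^ n ≤ 1 := by
      rw [hρn, Rat.cast_intCast]; exact Padic.norm_int_le_one m
    exact (pow_le_one_iff_of_nonneg hρ.le hn0.ne').1 this
  have hint : ∀ x : NumberField.RingOfIntegers K, Bd b p ρ 1 (x : K) := by
    intro x
    refine Bd_one_of_bounded b p hb hθ hn0 hρ hρn hmv hgcd (‖(D : ℚ_[p])‖⁻¹) fun k j => ?_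
    have h1 := hD (x ^ k)
    obtain ⟨z, hz⟩ := coords_of_mem b hb hθ hn0 h1 j
    have h2 : (D : K) * ((x ^ k : NumberField.RingOfIntegers K) : K) = (D : ℚ) • (x : K) ^ k := by
      rw [Algebra.smul_def, map_intCast]; simp
    rw [h2, map_smul, Finsupp.smul_apply, smul_eq_mul] at hz
    have h3 := congrArg (fun q : ℚ => ‖(q : ℚ_[p])‖) hz
    simp only [Rat.cast_mul, Rat.cast_intCast, norm_mul] at h3
    have hDn : 0 < ‖(D : ℚ_[p])‖ := by rw [norm_pos_iff]; exact_mod_cast hD0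
    have h4 := Padic.norm_int_le_one (p := p) z
    rw [← h3] at h4
    rw [← one_div, le_div_iff₀ hDn]
    have h5 : ρ ^ (j : ℕ) ≤ 1 := pow_le_one₀ hρ.le hρ1
    have h6 : 0 ≤ ρ ^ (j : ℕ) := by positivity
    have h7 := mul_le_one₀ h4 h6 h5
    have h8 : (((x : K) ^ k : K)) = ((x ^ k : NumberField.RingOfIntegers K) : K) := by simp
    linarith
  set f : ℕ → ℕ := fun j => j * v / n with hf
  -- the integral elements
  have hβ : ∀ j : Fin n, ∃ β : NumberField.RingOfIntegers K,
      (β : K) = ((p : ℚ) ^ f j)⁻¹ • (θ : K) ^ (j : ℕ) := by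
    intro j
    have hpK : (p : K) ≠ 0 := by exact_mod_cast hp.ne_zero
    have hdvd : (p : ℤ) ^ (f j * n) ∣ m ^ (j : ℕ) := by
      have h1 : (p : ℤ) ^ v ∣ m := padicValInt_dvd m
      have h2 := pow_dvd_pow_of_dvd h1 (j : ℕ)
      rw [← pow_mul] at h2
      refine (pow_dvd_pow _ ?_).trans h2
      rw [mul_comm v]
      exact Nat.div_mul_le_self _ _
    obtain ⟨c, hc⟩ := hdvd
    have hi : IsIntegral ℤ (((p : ℚ) ^ f j)⁻¹ • (θ : K) ^ (j : ℕ)) := by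
      refine IsIntegral.of_pow hn0 ?_
      have : (((p : ℚ) ^ f j)⁻¹ • (θ : K) ^ (j : ℕ)) ^ n = algebraMap ℤ K c := by
        rw [_root_.smul_pow, ← pow_mul, mul_comm (j : ℕ) n, pow_mul, hθ, ← Int.cast_pow, hc,
          Algebra.smul_def]
        push_cast
        rw [pow_mul, inv_pow, ← mul_assoc, inv_mul_cancel₀ (pow_ne_zero _ (pow_ne_zero _ hpK)),
          one_mul]
        simp
      rw [this]
      exact isIntegral_algebraMap
    exact ⟨⟨_, hi⟩, rfl⟩
  choose β hβ using hβ
  set ψ : (Fin n → ℤ) →ₗ[ℤ] NumberField.RingOfIntegers K := Fintype.linearCombination ℤ β with hψ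
  have hcoord : ∀ z j, b.repr (ψ z : K) j = z j * ((p : ℚ) ^ f j)⁻¹ := by
    intro z j
    have : (ψ z : K) = ∑ i, ((z i : ℚ) * ((p : ℚ) ^ f i)⁻¹) • b i := by
      rw [hψ, Fintype.linearCombination_apply, coe_sum_zsmul]
      refine Finset.sum_congr rfl fun i _ => ?_
      rw [hβ, hb, mul_smul, Int.cast_smul_eq_zsmul]
    rw [this, b.repr_sum_self]
  have hppos : ∀ k, (p : ℚ) ^ k ≠ 0 := fun k => pow_ne_zero _ (by exact_mod_cast hp.ne_zero)
  have hext : ∀ x y : NumberField.RingOfIntegers K,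
      (∀ j, b.repr (x : K) j = b.repr (y : K) j) → x = y := by
    intro x y h
    apply NumberField.RingOfIntegers.ext
    exact b.repr.injective (Finsupp.ext h)
  have hψinj : Function.Injective ψ := by
    intro z w h
    funext j
    have h1 := hcoord z j
    rw [h, hcoord w j] at h1
    exact_mod_cast (mul_right_cancel₀ (inv_ne_zero (hppos _)) h1).symm
  have hmemA : ∀ x : NumberField.RingOfIntegers K, x ∈ Algebra.adjoin ℤ {θ} ↔
      ∀ j, ∃ z : ℤ, b.repr (x : K) j = z := by
    intro x
    constructor
    · intro hx j
      refine coords_of_mem b hb hθ hn0 ?_ j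
      have h1 : (algebraMap (NumberField.RingOfIntegers K) K).toIntAlgHom x ∈
          (Algebra.adjoin ℤ {θ}).map (algebraMap (NumberField.RingOfIntegers K) K).toIntAlgHom :=
        Subalgebra.mem_map.2 ⟨x, hx, rfl⟩
      rw [AlgHom.map_adjoin, Set.image_singleton] at h1
      exact h1
    · intro h
      choose z hz using h
      have : x = ∑ j, z j • θ ^ (j : ℕ) := by
        apply NumberField.RingOfIntegers.ext
        rw [eq_sum b hb (x : K), coe_sum_zsmul]
        refine Finset.sum_congr rfl fun j _ => ?_
        rw [hz, Int.cast_smul_eq_zsmul]; rfl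
      rw [this]
      exact sum_mem_adjoin θ z
  have hA : (Subalgebra.toSubmodule (Algebra.adjoin ℤ {θ})).toAddSubgroup =
      (AddSubgroup.pi Set.univ (fun j : Fin n => AddSubgroup.zmultiples ((p : ℤ) ^ f j))).map
        ψ.toAddMonoidHom := by
    ext x
    rw [AddSubgroup.mem_map]
    change x ∈ Algebra.adjoin ℤ {θ} ↔ _
    rw [hmemA]
    constructor
    · intro h
      choose z hz using h
      refine ⟨fun j => z j * (p : ℤ) ^ f j, ?_, ?_⟩
      · intro j _
        exact Int.mem_zmultiples_iff.2 (dvd_mul_left _ _)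
      · refine hext _ _ fun j => ?_
        change b.repr (ψ _ : K) j = _
        rw [hcoord, hz]
        push_cast
        rw [mul_assoc, mul_inv_cancel₀ (hppos _), mul_one]
    · rintro ⟨w, hw, rfl⟩ j
      obtain ⟨z, hz⟩ := Int.mem_zmultiples_iff.1 (hw j (Set.mem_univ _))
      refine ⟨z, ?_⟩
      change b.repr (ψ _ : K) j = _
      rw [hcoord, hz]
      push_cast
      rw [mul_comm, ← mul_assoc, inv_mul_cancel₀ (hppos _), one_mul]
  have hker : ψ.toAddMonoidHom.ker = ⊥ := (AddMonoidHom.ker_eq_bot_iff _).2 hψinj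
  -- finiteness of the cokernel
  have hDmem : ∀ x : NumberField.RingOfIntegers K, D • x ∈ LinearMap.range ψ := by
    intro x
    have h1 : D • x ∈ Algebra.adjoin ℤ {θ} := by
      rw [hmemA]
      intro j
      obtain ⟨z, hz⟩ := coords_of_mem b hb hθ hn0 (hD x) j
      refine ⟨z, ?_⟩
      rw [← hz]
      simp
    have h2 : D • x ∈ (Subalgebra.toSubmodule (Algebra.adjoin ℤ {θ})).toAddSubgroup := h1
    rw [hA] at h2
    obtain ⟨w, -, hw⟩ := AddSubgroup.mem_map.1 h2
    exact ⟨w, hw⟩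
  have hfin : Finite (NumberField.RingOfIntegers K ⧸ LinearMap.range ψ) := by
    refine Module.finite_of_fg_torsion _ ?_
    intro y
    obtain ⟨x, rfl⟩ := Submodule.Quotient.mk_surjective _ y
    refine ⟨⟨D, mem_nonZeroDivisors_of_ne_zero hD0⟩, ?_⟩
    change D • (Submodule.Quotient.mk (p := LinearMap.range ψ) x) = _
    rw [← Submodule.Quotient.mk_smul, Submodule.Quotient.mk_eq_zero]
    exact hDmem x
  have hidx : ψ.toAddMonoidHom.range.index =
      Nat.card (NumberField.RingOfIntegers K ⧸ LinearMap.range ψ) := rfl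
  have hcop : ¬ p ∣ ψ.toAddMonoidHom.range.index := by
    rw [hidx]
    intro hdvd
    obtain ⟨y, hy⟩ := exists_prime_addOrderOf_dvd_card' p hdvd
    obtain ⟨x, rfl⟩ := Submodule.Quotient.mk_surjective _ y
    have hpx : p • x ∈ LinearMap.range ψ := by
      rw [← Submodule.Quotient.mk_eq_zero, Submodule.Quotient.mk_smul, ← hy]
      exact addOrderOf_nsmul_eq_zero _
    have hxn : x ∉ LinearMap.range ψ := by
      intro h
      rw [← Submodule.Quotient.mk_eq_zero] at h
      rw [h, addOrderOf_zero] at hy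
      exact hp.ne_one hy.symm
    apply hxn
    obtain ⟨z, hz⟩ := hpx
    have hzx : ∀ j, (z j : ℚ) = p * (b.repr (x : K) j * (p : ℚ) ^ f j) := by
      intro j
      have h1 := hcoord z j
      have h0 : ((p • x : NumberField.RingOfIntegers K) : K) = p • (x : K) :=
        map_nsmul (algebraMap (NumberField.RingOfIntegers K) K) p x
      rw [hz, h0, map_nsmul, Finsupp.smul_apply, nsmul_eq_mul] at h1
      rw [← mul_assoc, h1, mul_assoc, inv_mul_cancel₀ (hppos _), mul_one]
    have hdv : ∀ j, (p : ℤ) ∣ z j := by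
      intro j
      have h1 := val_bound p hρ hn0 (hρn.trans hmv) (hint x j)
      rw [← Padic.norm_intCast_lt_one_iff]
      have h2 := congrArg (fun q : ℚ => ‖(q : ℚ_[p])‖) (hzx j)
      simp only [Rat.cast_mul, Rat.cast_intCast, Rat.cast_pow, Rat.cast_natCast] at h2
      rw [h2, norm_mul, Padic.norm_p]
      have : (p : ℝ)⁻¹ < 1 := inv_lt_one_of_one_lt₀ hp1
      have h3 : (0 : ℝ) < (p : ℝ)⁻¹ := by positivity
      calc _ ≤ (p : ℝ)⁻¹ * 1 := mul_le_mul_of_nonneg_left h1 h3.le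
        _ < 1 := by linarith
    choose w hw using hdv
    refine ⟨w, hext _ _ fun j => ?_⟩
    rw [hcoord]
    have h1 := hzx j
    rw [hw] at h1
    push_cast at h1
    have h2 := mul_left_cancel₀ (by exact_mod_cast hp.ne_zero) h1
    rw [h2, mul_assoc, mul_inv_cancel₀ (hppos _), mul_one]
  have hne : ψ.toAddMonoidHom.range.index ≠ 0 := by
    rw [hidx]; exact Nat.card_pos.ne'
  rw [hA, AddSubgroup.index_map, hker, sup_bot_eq, AddSubgroup.index_pi]
  have hprod : ∏ i : Fin n, (AddSubgroup.zmultiples ((p : ℤ) ^ f i)).index =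
      p ^ (∑ j ∈ Finset.range n, j * v / n) := by
    simp only [Int.index_zmultiples, Int.natAbs_pow, Int.natAbs_natCast]
    rw [Finset.prod_pow_eq_pow_sum, Fin.sum_univ_eq_sum_range f n]
  rw [hprod, padicValNat.mul (pow_ne_zero _ hp.ne_zero) hne, padicValNat.prime_pow,
    padicValNat.eq_zero_of_not_dvd hcop, add_zero, floor_sum n v hn0 hv0]
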